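/- arXiv:2407.19863 — 2 statements merged into one kernel-verified Lean document; each statement's English description precedes it below -/
import Mathlib

section
/- Let P be a finite set of N processes with N ≥ 3f + 1, let F ⊆ P with |F| ≤ f be the Byzantine processes, and suppose each correct process (process in P \ F) casts at most one vote, recorded by a function vote : P → Option V. Then there cannot exist two distinct values v ≠ v' in V together with sets S, S' ⊆ P of sizes |S| ≥ N − f and |S'| ≥ N − f such that every p ∈ S \ F has vote p = some v and every p ∈ S' \ F has vote p = some v'. In particular, no two correct processes in Bracha's protocol vote for conflicting values. -/
/-- In Bracha's reliable broadcast with `N ≥ 3f + 1` processes, at most `f` of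
which are Byzantine, and each correct process casting at most one vote, there
cannot be two distinct values each backed by a quorum of size `N - f` whose
correct members all voted for that value. -/
theorem stmt_4 {P : Type*} {V : Type*} [Fintype P] [DecidableEq P] (N f : ℕ)
    (hN : Fintype.card P = N) (hNf : N ≥ 3 * f + 1) (F : Finset P)
    (hF : F.card ≤ f) (vote : P → Option V) :
    ¬ ∃ (v v' : V) (S S' : Finset P), v ≠ v' ∧
        S.card ≥ N - f ∧ S'.card ≥ N - f ∧
        (∀ p ∈ S \ F, vote p = some v) ∧
        (∀ p ∈ S' \ F, vote p = some v') := by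
  rintro ⟨v, v', S, S', hne, hS, hS', h, h'⟩
  have h1 := Finset.card_union_add_card_inter S S'
  have h2 : (S ∪ S').card ≤ N := hN ▸ Finset.card_le_univ _
  have h3 : F.card < (S ∩ S').card := by omega
  obtain ⟨p, hp, hpF⟩ := Finset.exists_mem_notMem_of_card_lt_card h3
  rw [Finset.mem_inter] at hp
  have a := h p (Finset.mem_sdiff.2 ⟨hp.1, hpF⟩)
  have b := h' p (Finset.mem_sdiff.2 ⟨hp.2, hpF⟩)
  exact hne (Option.some.inj (a.symm.trans b))
end

section
/- Let P be a finite set of N = 3f + 1 replicas, let F ⊆ P with |F| ≤ f be the faulty replicas, and fix a sequence number s. Suppose each correct replica (replica in P \ F) endorses at most one request for sequence number s, recorded by endorse : P → Option R (a correct leader sends a single pre-prepare for s, and a correct follower sends a single prepare for s). Then there cannot exist two distinct requests r ≠ r' together with sets S, S' ⊆ P of size 2f + 1 each, such that every p ∈ S \ F endorses r and every p ∈ S' \ F endorses r'. Hence no two certificates-of-prepare of size 2f + 1 for the same sequence number can support different requests, and PBFT achieves a unique sequence number within a view. -/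
/-- PBFT agreement within a view: with `N = 3f + 1` replicas, at most `f`
faulty, and each correct replica endorsing at most one request for sequence
number `s`, there cannot be two certificates-of-prepare of size `2f + 1`
supporting distinct requests. -/
theorem stmt_6 {P : Type*} {R : Type*} [Fintype P] [DecidableEq P] (N f : ℕ)
    (hN : Fintype.card P = N) (hNf : N = 3 * f + 1) (F : Finset P)
    (hF : F.card ≤ f) (endorse : P → Option R) :
    ¬ ∃ (r r' : R) (S S' : Finset P), r ≠ r' ∧
        S.card = 2 * f + 1 ∧ S'.card = 2 * f + 1 ∧
        (∀ p ∈ S \ F, endorse p = some r) ∧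
        (∀ p ∈ S' \ F, endorse p = some r') := by
  rintro ⟨r, r', S, S', hne, hS, hS', h, h'⟩
  have h1 := Finset.card_union_add_card_inter S S'
  have h2 := Finset.card_le_univ (S ∪ S')
  have h3 : F.card < (S ∩ S').card := by omega
  obtain ⟨p, hp, hpF⟩ := Finset.exists_mem_notMem_of_card_lt_card h3
  rw [Finset.mem_inter] at hp
  have e := h p (Finset.mem_sdiff.mpr ⟨hp.1, hpF⟩)
  have e' := h' p (Finset.mem_sdiff.mpr ⟨hp.2, hpF⟩)
  exact hne (Option.some.inj (e.symm.trans e'))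
end
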